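/- Let X be a countable set and μ an irreducible reversible Markov kernel on X with stationary probability measure m (with m(x) > 0 for all x). Let M_μ be the Markov operator on ℓ²(X,m), Δ_μ = I − M_μ the Laplacian, λ₁ = inf of the spectrum of Δ_μ restricted to ℓ²₀(X,m) = (ℂ·1_X)^⊥, and h(X) the Cheeger constant of the chain. Then h(X)²/8 ≤ λ₁. Consequently, if h(X) > 0 then λ₁ > 0. -/

import Mathlib

open MeasureTheory Filter Topology

/-- The measure on a countable state space `X` associated with a weight function
`m : X → ℝ`, giving mass `m x` to each point `x`. -/
noncomputable def weightMeasure {X : Type*} [MeasurableSpace X] (m : X → ℝ) : Measure X :=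
  Measure.sum fun x : X => ENNReal.ofReal (m x) • Measure.dirac x

/-- A symmetric operator on a nontrivial real Hilbert space has nonempty real spectrum. -/
lemma spectrum_nonempty_of_symmetric {H : Type*} [NormedAddCommGroup H] [InnerProductSpace ℝ H]
    [Nontrivial H] (T : H →L[ℝ] H)
    (hT : ∀ f g, inner ℝ (T f) g = inner ℝ f (T g)) : (spectrum ℝ T).Nonempty := by
  set S : Set ℝ := {r | ∃ f : H, f ≠ 0 ∧ r = inner ℝ (T f) f / ‖f‖ ^ 2} with hS
  have hSne : S.Nonempty := by
    obtain ⟨f, hf⟩ := exists_ne (0 : H)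
    exact ⟨_, f, hf, rfl⟩
  have hSbdd : BddBelow S := by
    refine ⟨-‖T‖, ?_⟩
    rintro r ⟨f, hf, rfl⟩
    have hf' : 0 < ‖f‖ ^ 2 := by positivity
    rw [le_div_iff₀ hf']
    have h1 := abs_real_inner_le_norm (T f) f
    have h2 := mul_le_mul_of_nonneg_right (T.le_opNorm f) (norm_nonneg f)
    have h3 := neg_abs_le (inner ℝ (T f) f)
    nlinarith
  set c := sInf S with hc
  refine ⟨c, fun hu => ?_⟩
  set P : H →L[ℝ] H := T - algebraMap ℝ (H →L[ℝ] H) c with hP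
  have hPf : ∀ f, P f = T f - c • f := fun f => by
    simp [hP, Algebra.algebraMap_eq_smul_one]
  have hPsymm : ∀ f g, inner ℝ (P f) g = inner ℝ f (P g) := fun f g => by
    simp only [hPf, inner_sub_left, inner_sub_right, hT, real_inner_smul_left,
      real_inner_smul_right]
  have hPpos : ∀ f, 0 ≤ inner ℝ (P f) f := fun f => by
    by_cases hf : f = 0
    · simp [hf]
    have hf' : 0 < ‖f‖ ^ 2 := by positivity
    have := csInf_le hSbdd (show _ ∈ S from ⟨f, hf, rfl⟩)
    rw [← hc, le_div_iff₀ hf'] at this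
    rw [hPf, inner_sub_left, real_inner_smul_left, real_inner_self_eq_norm_sq]
    linarith
  have hu' : IsUnit P := by
    have := hu.neg
    rwa [neg_sub] at this
  obtain ⟨R, hR⟩ := hu'.exists_left_inv
  have hbound : ∀ f, ‖f‖ ≤ ‖R‖ * ‖P f‖ := fun f => by
    have h1 : R (P f) = f := by
      simpa using DFunLike.congr_fun hR f
    calc ‖f‖ = ‖R (P f)‖ := by rw [h1]
      _ ≤ _ := R.le_opNorm _
  have hCS : ∀ f, ‖P f‖ ^ 2 ≤ ‖P‖ * inner ℝ (P f) f := fun f => by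
    have h1 := LinearMap.BilinForm.apply_mul_apply_le_of_forall_zero_le
      ((innerₗ H).comp P.toLinearMap) (fun f => by simpa using hPpos f) f (P f)
    simp only [LinearMap.comp_apply, ContinuousLinearMap.coe_coe, innerₗ_apply_apply] at h1
    rw [hPsymm (P f) f, real_inner_self_eq_norm_sq] at h1
    have h2 : inner ℝ (P (P f)) (P f) ≤ ‖P‖ * ‖P f‖ ^ 2 := by
      have := real_inner_le_norm (P (P f)) (P f)
      have := mul_le_mul_of_nonneg_right (P.le_opNorm (P f)) (norm_nonneg (P f))
      nlinarith
    by_cases h0 : P f = 0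
    · simp [h0]
    have h3 : 0 < ‖P f‖ ^ 2 := by positivity
    have h4 := mul_le_mul_of_nonneg_left h2 (hPpos f)
    refine le_of_mul_le_mul_right ?_ h3
    linarith
  set K := ‖R‖ ^ 2 * ‖P‖ + 1 with hK
  have hKpos : 0 < K := by positivity
  have hlow : c + 1 / K ≤ c := by
    refine le_csInf hSne ?_
    rintro r ⟨f, hf, rfl⟩
    have hf' : 0 < ‖f‖ ^ 2 := by positivity
    rw [le_div_iff₀ hf']
    have h1 : ‖f‖ ^ 2 ≤ K * inner ℝ (P f) f := by
      calc ‖f‖ ^ 2 ≤ (‖R‖ * ‖P f‖) ^ 2 := by gcongr; exact hbound f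
        _ = ‖R‖ ^ 2 * ‖P f‖ ^ 2 := by ring
        _ ≤ ‖R‖ ^ 2 * (‖P‖ * inner ℝ (P f) f) := by gcongr; exact hCS f
        _ ≤ _ := by rw [hK]; nlinarith [hPpos f]
    have h2 : 1 / K * ‖f‖ ^ 2 ≤ inner ℝ (P f) f := by
      rw [div_mul_eq_mul_div, one_mul, div_le_iff₀ hKpos]
      linarith
    rw [hPf, inner_sub_left, real_inner_smul_left, real_inner_self_eq_norm_sq] at h2
    linarith
  have : 0 < 1 / K := by positivity
  linarith

/-- A lower bound for the quadratic form of an operator bounds its real spectrum from below. -/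
lemma le_of_mem_spectrum_of_forall_le_inner {H : Type*} [NormedAddCommGroup H]
    [InnerProductSpace ℝ H] [CompleteSpace H] (T : H →L[ℝ] H) {c : ℝ}
    (hT : ∀ f, c * ‖f‖ ^ 2 ≤ inner ℝ (T f) f) {t : ℝ} (ht : t ∈ spectrum ℝ T) : c ≤ t := by
  by_contra! hlt
  have hu : IsUnit (T - algebraMap ℝ (H →L[ℝ] H) t) := by
    refine ContinuousLinearMap.isUnit_of_forall_le_norm_inner_map _
      (c := (c - t).toNNReal) (by simpa using hlt) fun f => ?_
    refine le_trans ?_ (le_abs_self _)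
    have : (T - algebraMap ℝ (H →L[ℝ] H) t) f = T f - t • f := by
      simp [Algebra.algebraMap_eq_smul_one]
    rw [this, inner_sub_left, real_inner_smul_left, real_inner_self_eq_norm_sq,
      Real.coe_toNNReal _ (by linarith)]
    linarith [hT f]
  apply ht
  have := hu.neg
  rwa [neg_sub] at this

/-- The **coarea formula** for weighted sums of increments. -/
lemma tsum_ofReal_sub_mul_eq_lintegral {X : Type*} [Countable X] (W : X → X → ENNReal)
    (F : X → ℝ) :
    ∑' x, ∑' y, ENNReal.ofReal (F x - F y) * W x y =
      ∫⁻ t : ℝ, ∑' x : {x | t < F x}, ∑' y : ↥{x | t < F x}ᶜ, W x y := by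
  have key : ∀ t : ℝ, ∑' x : {x | t < F x}, ∑' y : ↥{x | t < F x}ᶜ, W x y =
      ∑' x, ∑' y, (Set.Ico (F y) (F x)).indicator (fun _ => W x y) t := fun t => by
    rw [tsum_subtype {x | t < F x} (fun x => ∑' y : ↥{x | t < F x}ᶜ, W x y)]
    refine tsum_congr fun x => ?_
    by_cases hx : t < F x
    · rw [Set.indicator_of_mem (by exact hx), tsum_subtype _ (fun y => W x y)]
      refine tsum_congr fun y => ?_
      by_cases hy : t < F y <;> simp [Set.indicator, hx, hy, not_le.2, le_of_not_gt]
    · rw [Set.indicator_of_notMem (by exact hx)]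
      simp [Set.indicator, hx]
  have hmeas : ∀ x y, Measurable ((Set.Ico (F y) (F x)).indicator (fun _ => W x y)) :=
    fun x y => measurable_const.indicator measurableSet_Ico
  simp_rw [key]
  rw [lintegral_tsum fun x => (Measurable.tsum fun y => hmeas x y).aemeasurable]
  refine tsum_congr fun x => ?_
  rw [lintegral_tsum fun y => (hmeas x y).aemeasurable]
  refine tsum_congr fun y => ?_
  rw [lintegral_indicator_const measurableSet_Ico, Real.volume_Ico, mul_comm]

lemma tsum_ofReal_abs_sub_mul {X : Type*} (W : X → X → ENNReal) (hW : ∀ x y, W x y = W y x)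
    (F : X → ℝ) :
    ∑' x, ∑' y, ENNReal.ofReal |F x - F y| * W x y =
      2 * ∑' x, ∑' y, ENNReal.ofReal (F x - F y) * W x y := by
  have habs : ∀ x y, ENNReal.ofReal |F x - F y| * W x y =
      ENNReal.ofReal (F x - F y) * W x y + ENNReal.ofReal (F y - F x) * W y x := fun x y => by
    rw [hW y x, ← add_mul]
    congr 1
    rcases le_total (F x) (F y) with h | h
    · rw [abs_of_nonpos (by linarith), ENNReal.ofReal_of_nonpos (p := F x - F y) (by linarith),
        zero_add, neg_sub]
    · rw [abs_of_nonneg (by linarith), ENNReal.ofReal_of_nonpos (p := F y - F x) (by linarith),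
        add_zero]
  simp_rw [habs, ENNReal.tsum_add]
  rw [ENNReal.tsum_comm (f := fun x y => ENNReal.ofReal (F y - F x) * W y x), two_mul]

/-- An isoperimetric inequality for all sets implies its functional `L¹` version. -/
lemma mul_tsum_ofReal_abs_sub_le {X : Type*} [Countable X] (V W : X → X → ENNReal)
    (hV : ∀ x y, V x y = V y x) (hW : ∀ x y, W x y = W y x) (c : ENNReal)
    (hVW : ∀ S : Set X, c * ∑' x : S, ∑' y : ↥Sᶜ, V x y ≤ ∑' x : S, ∑' y : ↥Sᶜ, W x y)
    (F : X → ℝ) :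
    c * ∑' x, ∑' y, ENNReal.ofReal |F x - F y| * V x y ≤
      ∑' x, ∑' y, ENNReal.ofReal |F x - F y| * W x y := by
  rw [tsum_ofReal_abs_sub_mul V hV, tsum_ofReal_abs_sub_mul W hW, mul_left_comm,
    tsum_ofReal_sub_mul_eq_lintegral, tsum_ofReal_sub_mul_eq_lintegral]
  gcongr
  exact (lintegral_const_mul_le _ _).trans (lintegral_mono fun t => hVW _)

/-- **Cauchy–Schwarz** for weighted sums. -/
lemma sq_tsum_mul_le {ι : Type*} (w u v : ι → ℝ) (hw : ∀ i, 0 ≤ w i)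
    (hu : Summable fun i => w i * u i ^ 2) (hv : Summable fun i => w i * v i ^ 2) :
    Summable (fun i => w i * (u i * v i)) ∧
    (∑' i, w i * (u i * v i)) ^ 2 ≤ (∑' i, w i * u i ^ 2) * ∑' i, w i * v i ^ 2 := by
  have huv : Summable fun i => w i * (u i * v i) := by
    refine Summable.of_norm_bounded (hu.add hv) fun i => ?_
    rw [Real.norm_eq_abs, abs_mul, abs_of_nonneg (hw i), ← mul_add]
    refine mul_le_mul_of_nonneg_left ?_ (hw i)
    rw [abs_le]
    constructor <;> nlinarith [sq_nonneg (u i + v i), sq_nonneg (u i - v i),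
      sq_nonneg (u i), sq_nonneg (v i)]
  refine ⟨huv, ?_⟩
  have h := discrim_le_zero (a := ∑' i, w i * u i ^ 2) (b := 2 * ∑' i, w i * (u i * v i))
    (c := ∑' i, w i * v i ^ 2) fun t => by
      have h1 : 0 ≤ ∑' i, w i * (t * u i + v i) ^ 2 :=
        tsum_nonneg fun i => mul_nonneg (hw i) (sq_nonneg _)
      have h2 : HasSum (fun i => w i * (t * u i + v i) ^ 2) _ :=
        (((hu.hasSum.mul_right (t * t)).add ((huv.hasSum.mul_left 2).mul_right t)).add
          hv.hasSum).congr_fun fun i => by ring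
      rwa [h2.tsum_eq] at h1
  rw [discrim] at h
  nlinarith

lemma weightMeasure_singleton {X : Type*} [MeasurableSpace X] [MeasurableSingletonClass X]
    (m : X → ℝ) (x : X) : weightMeasure m {x} = ENNReal.ofReal (m x) := by
  rw [weightMeasure, Measure.sum_apply _ (measurableSet_singleton x), tsum_eq_single x]
  · simp
  · intro y hy
    simp [hy]

lemma ae_weightMeasure_iff {X : Type*} [MeasurableSpace X] [MeasurableSingletonClass X]
    {m : X → ℝ} (hmpos : ∀ x, 0 < m x) {p : X → Prop} :
    (∀ᵐ x ∂(weightMeasure m), p x) ↔ ∀ x, p x := by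
  refine ⟨fun h x => ?_, fun h => ae_of_all _ h⟩
  by_contra hx
  have h1 : weightMeasure m {x} ≤ 0 :=
    (measure_mono (Set.singleton_subset_iff.2 hx)).trans_eq (ae_iff.1 h)
  rw [weightMeasure_singleton, nonpos_iff_eq_zero, ENNReal.ofReal_eq_zero] at h1
  exact (hmpos x).not_ge h1

lemma isProbabilityMeasure_weightMeasure {X : Type*} [MeasurableSpace X] {m : X → ℝ}
    (hmpos : ∀ x, 0 < m x) (hprob : HasSum m 1) : IsProbabilityMeasure (weightMeasure m) := by
  refine ⟨?_⟩
  rw [weightMeasure, Measure.sum_apply _ MeasurableSet.univ]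
  simp [← ENNReal.ofReal_tsum_of_nonneg (fun x => (hmpos x).le) hprob.summable, hprob.tsum_eq]

lemma hasSum_integral_weightMeasure {X : Type*} [MeasurableSpace X] [MeasurableSingletonClass X]
    {m : X → ℝ} (hmpos : ∀ x, 0 < m x) {g : X → ℝ} (hg : Integrable g (weightMeasure m)) :
    HasSum (fun x => m x * g x) (∫ x, g x ∂(weightMeasure m)) := by
  have := hasSum_integral_measure hg
  simpa [weightMeasure, integral_smul_measure, ENNReal.toReal_ofReal (hmpos _).le] using this

lemma sub_sq_le_abs_sq_sub_sq {a s : ℝ} (ha : 0 ≤ a) (hs : 0 ≤ s) :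
    a ^ 2 + s ^ 2 - 2 * s * a ≤ |a ^ 2 - s ^ 2| := by
  rcases le_total a s with h | h
  · rw [abs_of_nonpos] <;> nlinarith
  · rw [abs_of_nonneg] <;> nlinarith

section Markov

variable {X : Type*} {μ : X → X → ℝ} {m : X → ℝ}

lemma hasSum_edge_fst (hpos : ∀ x y, 0 ≤ μ x y) (hrow : ∀ x, HasSum (μ x) 1)
    (hmpos : ∀ x, 0 < m x) {g : X → ℝ} (hg0 : ∀ x, 0 ≤ g x) (hg : Summable fun x => m x * g x) :
    HasSum (fun p : X × X => m p.1 * μ p.1 p.2 * g p.1) (∑' x, m x * g x) := by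
  have h1 : ∀ x, HasSum (fun y => m x * μ x y * g x) (m x * g x) := fun x => by
    simpa using ((hrow x).mul_left (m x)).mul_right (g x)
  have hs : Summable fun p : X × X => m p.1 * μ p.1 p.2 * g p.1 := by
    rw [summable_prod_of_nonneg fun p => mul_nonneg (mul_nonneg (hmpos _).le (hpos _ _)) (hg0 _)]
    refine ⟨fun x => (h1 x).summable, ?_⟩
    simpa only [(h1 _).tsum_eq] using hg
  have h2 := hs.tsum_prod' fun x => (h1 x).summable
  simp only [(h1 _).tsum_eq] at h2
  exact h2 ▸ hs.hasSum

lemma hasSum_edge_snd (hpos : ∀ x y, 0 ≤ μ x y) (hrow : ∀ x, HasSum (μ x) 1)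
    (hrev : ∀ x y, m x * μ x y = m y * μ y x)
    (hmpos : ∀ x, 0 < m x) {g : X → ℝ} (hg0 : ∀ x, 0 ≤ g x) (hg : Summable fun x => m x * g x) :
    HasSum (fun p : X × X => m p.1 * μ p.1 p.2 * g p.2) (∑' x, m x * g x) := by
  rw [← (Equiv.prodComm X X).hasSum_iff]
  refine (hasSum_edge_fst hpos hrow hmpos hg0 hg).congr_fun fun p => ?_
  simp [hrev p.2 p.1]

/-- The `L¹` form of the isoperimetric inequality. -/
lemma mul_tsum_abs_sub_mean_le [Countable X] (hpos : ∀ x y, 0 ≤ μ x y)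
    (hrow : ∀ x, HasSum (μ x) 1) (hrev : ∀ x y, m x * μ x y = m y * μ y x)
    (hmpos : ∀ x, 0 < m x) (hprob : HasSum m 1) {c : ℝ} (hc : 0 ≤ c)
    (hcut : ∀ S : Set X, c * ((∑' x : S, m x) * ∑' y : ↥Sᶜ, m y) ≤
      ∑' (x : S) (y : ↥Sᶜ), m x * μ x y)
    {F : X → ℝ} (hF : Summable fun x => m x * F x)
    (hFw : Summable fun p : X × X => m p.1 * μ p.1 p.2 * |F p.1 - F p.2|) :
    c * ∑' x, m x * |F x - ∑' y, m y * F y| ≤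
      ∑' p : X × X, m p.1 * μ p.1 p.2 * |F p.1 - F p.2| := by
  have hw0 : ∀ x y, 0 ≤ m x * μ x y := fun x y => mul_nonneg (hmpos x).le (hpos x y)
  have hcutE : ∀ S : Set X, ENNReal.ofReal c *
      ∑' x : S, ∑' y : ↥Sᶜ, ENNReal.ofReal (m x) * ENNReal.ofReal (m y) ≤
      ∑' x : S, ∑' y : ↥Sᶜ, ENNReal.ofReal (m x * μ x y) := fun S => by
    have hsum : ∀ x : X, Summable fun y : ↥Sᶜ => m x * μ x y := fun x =>
      ((hrow x).summable.subtype Sᶜ).mul_left _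
    have hsum' : Summable fun x : S => ∑' y : ↥Sᶜ, m x * μ x y := by
      refine Summable.of_nonneg_of_le (fun x => tsum_nonneg fun y => hw0 _ _) (fun x => ?_)
        (hprob.summable.subtype S)
      rw [tsum_mul_left]
      refine mul_le_of_le_one_right (hmpos _).le ?_
      rw [← (hrow x).tsum_eq]
      exact (hrow x).summable.tsum_subtype_le _ Sᶜ (hpos x)
    have h := ENNReal.ofReal_le_ofReal (hcut S)
    rw [ENNReal.ofReal_mul hc, ENNReal.ofReal_mul (tsum_nonneg fun x => (hmpos _).le),
      ENNReal.ofReal_tsum_of_nonneg (f := fun x : ↥S => m x) (fun x => (hmpos _).le)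
        (hprob.summable.subtype S),
      ENNReal.ofReal_tsum_of_nonneg (f := fun x : ↥Sᶜ => m x) (fun x => (hmpos _).le)
        (hprob.summable.subtype Sᶜ),
      ENNReal.ofReal_tsum_of_nonneg (fun x => tsum_nonneg fun y => hw0 _ _) hsum'] at h
    simp_rw [ENNReal.tsum_mul_left, ENNReal.tsum_mul_right]
    refine h.trans_eq (tsum_congr fun x => ?_)
    exact ENNReal.ofReal_tsum_of_nonneg (fun y => hw0 _ _) (hsum x)
  have hmain := mul_tsum_ofReal_abs_sub_le (fun x y => ENNReal.ofReal (m x) * ENNReal.ofReal (m y))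
    (fun x y => ENNReal.ofReal (m x * μ x y)) (fun x y => mul_comm _ _)
    (fun x y => by rw [hrev]) (ENNReal.ofReal c) hcutE F
  set a := ∑' y, m y * F y with ha
  have hFa : Summable fun x => m x * |F x - a| := by
    refine (hF.abs.add (hprob.summable.mul_right |a|)).of_nonneg_of_le
      (fun x => mul_nonneg (hmpos x).le (abs_nonneg _)) fun x => ?_
    rw [abs_mul, abs_of_pos (hmpos x), ← mul_add]
    exact mul_le_mul_of_nonneg_left (abs_sub _ _) (hmpos x).le
  have hx : ∀ x, ENNReal.ofReal (m x * |F x - a|) ≤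
      ∑' y, ENNReal.ofReal |F x - F y| * (ENNReal.ofReal (m x) * ENNReal.ofReal (m y)) :=
      fun x => by
    have h1 : HasSum (fun y => m y * (F x - F y)) (F x - a) := by
      simpa [mul_sub] using (hprob.mul_right (F x)).sub hF.hasSum
    have h2 : Summable fun y => m y * |F x - F y| := by
      simpa [abs_mul, abs_of_pos (hmpos _)] using h1.summable.abs
    have h3 : |F x - a| ≤ ∑' y, m y * |F x - F y| := by
      have := norm_tsum_le_tsum_norm h1.summable.norm
      simpa [h1.tsum_eq, abs_mul, abs_of_pos (hmpos _)] using this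
    calc ENNReal.ofReal (m x * |F x - a|)
        ≤ ENNReal.ofReal (m x * ∑' y, m y * |F x - F y|) :=
          ENNReal.ofReal_le_ofReal (mul_le_mul_of_nonneg_left h3 (hmpos x).le)
      _ = _ := by
        rw [ENNReal.ofReal_mul (hmpos x).le, ENNReal.ofReal_tsum_of_nonneg
          (fun y => mul_nonneg (hmpos y).le (abs_nonneg _)) h2, ← ENNReal.tsum_mul_left]
        refine tsum_congr fun y => ?_
        rw [ENNReal.ofReal_mul (hmpos y).le]
        ring
  rw [← ENNReal.ofReal_le_ofReal_iff
    (tsum_nonneg fun p => mul_nonneg (hw0 _ _) (abs_nonneg _)), ENNReal.ofReal_mul hc,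
    ENNReal.ofReal_tsum_of_nonneg (fun x => mul_nonneg (hmpos x).le (abs_nonneg _)) hFa,
    ENNReal.ofReal_tsum_of_nonneg (fun p => mul_nonneg (hw0 _ _) (abs_nonneg _)) hFw,
    ENNReal.tsum_prod']
  calc _ ≤ ENNReal.ofReal c * ∑' x, ∑' y, ENNReal.ofReal |F x - F y| *
        (ENNReal.ofReal (m x) * ENNReal.ofReal (m y)) := by gcongr; exact hx _
    _ ≤ _ := hmain
    _ = _ := by
      refine tsum_congr fun x => tsum_congr fun y => ?_
      rw [ENNReal.ofReal_mul (hw0 x y), mul_comm]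

/-- The Dirichlet form bound behind **Cheeger's inequality**. -/
lemma sq_mul_tsum_sq_le_dirichlet [Countable X] (hpos : ∀ x y, 0 ≤ μ x y)
    (hrow : ∀ x, HasSum (μ x) 1) (hrev : ∀ x y, m x * μ x y = m y * μ y x)
    (hmpos : ∀ x, 0 < m x) (hprob : HasSum m 1) {c : ℝ} (hc : 0 ≤ c)
    (hcut : ∀ S : Set X, c * ((∑' x : S, m x) * ∑' y : ↥Sᶜ, m y) ≤
      ∑' (x : S) (y : ↥Sᶜ), m x * μ x y)
    {f : X → ℝ} (hf : Summable fun x => m x * f x ^ 2) (hf0 : HasSum (fun x => m x * f x) 0) :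
    c ^ 2 * ∑' x, m x * f x ^ 2 ≤ 8 * (∑' x, m x * f x ^ 2 -
      ∑' p : X × X, m p.1 * μ p.1 p.2 * (f p.1 * f p.2)) := by
  set N := ∑' x, m x * f x ^ 2 with hN
  set w : X × X → ℝ := fun p => m p.1 * μ p.1 p.2 with hwdef
  have hw0 : ∀ p, 0 ≤ w p := fun p => mul_nonneg (hmpos _).le (hpos _ _)
  have hN0 : 0 ≤ N := tsum_nonneg fun x => mul_nonneg (hmpos x).le (sq_nonneg _)
  have h1 : HasSum (fun p => w p * f p.1 ^ 2) N :=
    hasSum_edge_fst hpos hrow hmpos (g := fun x => f x ^ 2) (fun x => sq_nonneg _) hf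
  have h2 : HasSum (fun p => w p * f p.2 ^ 2) N :=
    hasSum_edge_snd hpos hrow hrev hmpos (g := fun x => f x ^ 2) (fun x => sq_nonneg _) hf
  have hcross := (sq_tsum_mul_le w (fun p => f p.1) (fun p => f p.2) hw0 h1.summable
    h2.summable).1
  set C := ∑' p : X × X, w p * (f p.1 * f p.2) with hC
  have hone : HasSum (fun p => w p * 1 ^ 2) 1 := by
    simpa [hprob.tsum_eq] using hasSum_edge_fst hpos hrow hmpos (g := fun _ => 1)
      (fun _ => zero_le_one) (by simpa using hprob.summable)
  have hsub : HasSum (fun p => w p * |f p.1 - f p.2| ^ 2) (2 * (N - C)) := by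
    have := (h1.add h2).sub (hcross.hasSum.mul_left 2)
    rw [show 2 * (N - C) = N + N - 2 * C by ring]
    exact this.congr_fun fun p => by rw [sq_abs]; ring
  have hadd : HasSum (fun p => w p * |f p.1 + f p.2| ^ 2) (2 * (N + C)) := by
    have := (h1.add h2).add (hcross.hasSum.mul_left 2)
    rw [show 2 * (N + C) = N + N + 2 * C by ring]
    exact this.congr_fun fun p => by rw [sq_abs]; ring
  have hE0 : 0 ≤ 2 * (N - C) := hsub.nonneg fun p => mul_nonneg (hw0 p) (sq_nonneg _)
  obtain ⟨hs1, hcs1⟩ := sq_tsum_mul_le w (fun p => |f p.1 - f p.2|) (fun _ => 1) hw0 hsub.summable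
    hone.summable
  obtain ⟨hs2, hcs2⟩ := sq_tsum_mul_le w (fun p => |f p.1 - f p.2|) (fun p => |f p.1 + f p.2|) hw0
    hsub.summable hadd.summable
  rw [hsub.tsum_eq, hone.tsum_eq] at hcs1
  rw [hsub.tsum_eq, hadd.tsum_eq] at hcs2
  have hsq : ∀ p : X × X, |f p.1 - f p.2| * |f p.1 + f p.2| = |f p.1 ^ 2 - f p.2 ^ 2| := fun p => by
    rw [← abs_mul]; congr 1; ring
  simp only [hsq] at hs2 hcs2
  simp only [mul_one] at hs1 hcs1
  have hL1 := mul_tsum_abs_sub_mean_le hpos hrow hrev hmpos hprob hc hcut hf0.summable hs1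
  have hL2 := mul_tsum_abs_sub_mean_le hpos hrow hrev hmpos hprob hc hcut hf hs2
  simp only [hf0.tsum_eq, sub_zero] at hL1
  rw [← hN] at hL2
  set s := Real.sqrt N with hs
  have hsN : s ^ 2 = N := Real.sq_sqrt hN0
  have hs0 : 0 ≤ s := Real.sqrt_nonneg _
  have hA : Summable fun x => m x * |f x| := by
    simpa [abs_mul, abs_of_pos (hmpos _)] using hf0.summable.abs
  set A := ∑' x, m x * |f x| with hAdef
  rcases le_total (s / 2) A with hcase | hcase
  · have h3 : c * (s / 2) ≤ ∑' p : X × X, w p * |f p.1 - f p.2| :=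
      (mul_le_mul_of_nonneg_left hcase hc).trans hL1
    have h4 := pow_le_pow_left₀ (by positivity) h3 2
    have : (c * (s / 2)) ^ 2 = c ^ 2 * N / 4 := by rw [← hsN]; ring
    linarith
  · have hD : Summable fun x => m x * |f x ^ 2 - N| := by
      have h := (hf.sub (hprob.summable.mul_right N)).abs
      simp only [← mul_sub, abs_mul, abs_of_pos (hmpos _)] at h
      exact h
    have h3 : N ≤ ∑' x, m x * |f x ^ 2 - N| := by
      have hlow : HasSum (fun x => m x * (f x ^ 2 - N + 2 * (s ^ 2 - s * |f x|)))
          (N - 1 * N + 2 * (1 * s ^ 2 - s * A)) :=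
        ((hf.hasSum.sub (hprob.mul_right N)).add
          (((hprob.mul_right (s ^ 2)).sub (hA.hasSum.mul_left s)).mul_left 2)).congr_fun
            fun x => by ring
      have hle := hasSum_le (fun x => mul_le_mul_of_nonneg_left (show
        f x ^ 2 - N + 2 * (s ^ 2 - s * |f x|) ≤ |f x ^ 2 - N| by
          rw [← hsN]
          have h := sub_sq_le_abs_sq_sub_sq (abs_nonneg (f x)) hs0
          rw [sq_abs] at h
          linarith [sq_abs (f x)]) (hmpos x).le) hlow hD.hasSum
      nlinarith
    have h4 : c * N ≤ _ := (mul_le_mul_of_nonneg_left h3 hc).trans hL2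
    have h5 := pow_le_pow_left₀ (by positivity) h4 2
    have hadd' : 2 * (N + C) ≤ 4 * N := by linarith
    have h6 := mul_le_mul_of_nonneg_left hadd' hE0
    rcases hN0.eq_or_lt with h0 | h0
    · rw [← h0] at hE0 ⊢
      linarith
    · refine le_of_mul_le_mul_right ?_ h0
      nlinarith

end Markov

/-- The inner product of `L²(X, m)` as a sum over the state space. -/
lemma hasSum_inner_weightMeasure {X : Type*} [MeasurableSpace X] [MeasurableSingletonClass X]
    {m : X → ℝ} (hmpos : ∀ x, 0 < m x) (f g : Lp ℝ 2 (weightMeasure m)) :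
    HasSum (fun x => m x * (f x * g x)) (inner ℝ f g) := by
  rw [L2.inner_def]
  refine (hasSum_integral_weightMeasure hmpos (L2.integrable_inner f g)).congr_fun fun x => ?_
  simp [mul_comm]

lemma summable_mul_sq_weightMeasure {X : Type*} [MeasurableSpace X] [MeasurableSingletonClass X]
    {m : X → ℝ} (hmpos : ∀ x, 0 < m x) (f : Lp ℝ 2 (weightMeasure m)) :
    Summable fun x => m x * f x ^ 2 := by
  simpa only [sq] using (hasSum_inner_weightMeasure hmpos f f).summable

lemma tsum_mul_sq_weightMeasure {X : Type*} [MeasurableSpace X] [MeasurableSingletonClass X]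
    {m : X → ℝ} (hmpos : ∀ x, 0 < m x) (f : Lp ℝ 2 (weightMeasure m)) :
    ∑' x, m x * f x ^ 2 = ‖f‖ ^ 2 := by
  rw [← real_inner_self_eq_norm_sq, ← (hasSum_inner_weightMeasure hmpos f f).tsum_eq]
  simp only [sq]

/-- The bilinear form of the Markov operator as a sum over edges. -/
lemma inner_markov_eq_tsum {X : Type*} [MeasurableSpace X] [MeasurableSingletonClass X]
    {μ : X → X → ℝ} {m : X → ℝ} (hpos : ∀ x y, 0 ≤ μ x y) (hrow : ∀ x, HasSum (μ x) 1)
    (hrev : ∀ x y, m x * μ x y = m y * μ y x) (hmpos : ∀ x, 0 < m x)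
    {M : Lp ℝ 2 (weightMeasure m) →L[ℝ] Lp ℝ 2 (weightMeasure m)}
    (hM : ∀ f : Lp ℝ 2 (weightMeasure m), ∀ᵐ x ∂(weightMeasure m),
      (M f) x = ∑' y : X, μ x y * f y) (f g : Lp ℝ 2 (weightMeasure m)) :
    inner ℝ (M f) g = ∑' p : X × X, m p.1 * μ p.1 p.2 * (g p.1 * f p.2) := by
  have hs := (sq_tsum_mul_le (fun p : X × X => m p.1 * μ p.1 p.2) (fun p => g p.1)
    (fun p => f p.2) (fun p => mul_nonneg (hmpos _).le (hpos _ _))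
    (hasSum_edge_fst hpos hrow hmpos (g := fun x => g x ^ 2) (fun x => sq_nonneg _)
      (summable_mul_sq_weightMeasure hmpos g)).summable
    (hasSum_edge_snd hpos hrow hrev hmpos (g := fun x => f x ^ 2) (fun x => sq_nonneg _)
      (summable_mul_sq_weightMeasure hmpos f)).summable).1
  rw [← (hasSum_inner_weightMeasure hmpos (M f) g).tsum_eq, hs.tsum_prod]
  refine tsum_congr fun x => ?_
  rw [(ae_weightMeasure_iff hmpos).1 (hM f) x, ← tsum_mul_right, ← tsum_mul_left]
  exact tsum_congr fun y => by ring

lemma inner_markov_comm {X : Type*} [MeasurableSpace X] [MeasurableSingletonClass X]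
    {μ : X → X → ℝ} {m : X → ℝ} (hpos : ∀ x y, 0 ≤ μ x y) (hrow : ∀ x, HasSum (μ x) 1)
    (hrev : ∀ x y, m x * μ x y = m y * μ y x) (hmpos : ∀ x, 0 < m x)
    {M : Lp ℝ 2 (weightMeasure m) →L[ℝ] Lp ℝ 2 (weightMeasure m)}
    (hM : ∀ f : Lp ℝ 2 (weightMeasure m), ∀ᵐ x ∂(weightMeasure m),
      (M f) x = ∑' y : X, μ x y * f y) (f g : Lp ℝ 2 (weightMeasure m)) :
    inner ℝ (M f) g = inner ℝ f (M g) := by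
  rw [real_inner_comm (M g) f, inner_markov_eq_tsum hpos hrow hrev hmpos hM,
    inner_markov_eq_tsum hpos hrow hrev hmpos hM, ← (Equiv.prodComm X X).tsum_eq]
  refine tsum_congr fun p => ?_
  simp only [Equiv.prodComm_apply, Prod.fst_swap, Prod.snd_swap]
  rw [hrev p.2 p.1, mul_comm (g p.2)]

lemma exists_ne_zero_integral_eq_zero {X : Type*} [Countable X] [MeasurableSpace X]
    [MeasurableSingletonClass X] [Nontrivial X] {m : X → ℝ} (hmpos : ∀ x, 0 < m x)
    (hprob : HasSum m 1) :
    ∃ f : Lp ℝ 2 (weightMeasure m), f ≠ 0 ∧ ∫ x, f x ∂(weightMeasure m) = 0 := by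
  classical
  have := isProbabilityMeasure_weightMeasure hmpos hprob
  obtain ⟨a, b, hab⟩ := exists_pair_ne X
  set g : X → ℝ := Pi.single a (m a)⁻¹ - Pi.single b (m b)⁻¹ with hg
  have hsingle : ∀ c x, ‖(Pi.single c (m c)⁻¹ : X → ℝ) x‖ ≤ (m c)⁻¹ := fun c x => by
    rcases eq_or_ne x c with rfl | hx
    · simp [abs_of_pos (hmpos _)]
    · simp [hx, (hmpos c).le]
  have hgL : MemLp g 2 (weightMeasure m) := by
    refine MemLp.of_bound (measurable_of_countable g).aestronglyMeasurable
      ((m a)⁻¹ + (m b)⁻¹) (ae_of_all _ fun x => ?_)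
    refine (norm_sub_le _ _).trans (add_le_add ?_ ?_)
    exacts [hsingle a x, hsingle b x]
  have hga : ∀ x, hgL.toLp g x = g x := (ae_weightMeasure_iff hmpos).1 hgL.coeFn_toLp
  refine ⟨hgL.toLp g, fun h0 => ?_, ?_⟩
  · have h1 := hga a
    rw [h0, (ae_weightMeasure_iff hmpos).1 (Lp.coeFn_zero ℝ 2 (weightMeasure m)) a] at h1
    simp [hg, hab] at h1
    exact (hmpos a).ne h1
  · simp only [hga]
    rw [← (hasSum_integral_weightMeasure hmpos (hgL.integrable one_le_two)).tsum_eq]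
    have h1 : ∀ c, HasSum (fun x => m x * (Pi.single c (m c)⁻¹ : X → ℝ) x) 1 := fun c => by
      convert hasSum_single c ?_ using 1
      · simp [(hmpos c).ne']
      · intro x hx
        simp [hx]
    have h2 := (h1 a).sub (h1 b)
    simp only [← mul_sub, sub_self] at h2
    exact h2.tsum_eq

lemma isClosed_setOf_integral_eq_zero {X : Type*} [MeasurableSpace X] (P : Measure X)
    [IsProbabilityMeasure P] : IsClosed {f : Lp ℝ 2 P | ∫ x, f x ∂P = 0} := by
  have h : ∀ f : Lp ℝ 2 P, ∫ x, f x ∂P =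
      inner ℝ (indicatorConstLp 2 MeasurableSet.univ (measure_ne_top P _) (1 : ℝ)) f := fun f => by
    rw [L2.inner_indicatorConstLp_one, setIntegral_univ]
  simp only [h]
  exact isClosed_eq (continuous_const.inner continuous_id) continuous_const

/-- **Cheeger's inequality for Markov chains (Lawler–Sokal; Sinclair).**
Let `μ` be an irreducible reversible Markov kernel on a countable set `X` with stationary
probability measure `m` (with `m x > 0` for all `x`), let `M` be the Markov operator on
`ℓ²(X,m)`, `Δ = I - M` the Laplacian, `λ₁` the infimum of the spectrum of `Δ` restricted to
`ℓ²₀(X,m) = (ℝ·1)^⊥`, and `h(X)` the Cheeger constant of the chain.  Then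
`h(X)²/8 ≤ λ₁`; consequently, if `h(X) > 0` then `λ₁ > 0`. -/
theorem cheeger_inequality_markov
    {X : Type*} [Countable X] [MeasurableSpace X] [MeasurableSingletonClass X]
    (μ : X → X → ℝ) (m : X → ℝ)
    (hpos : ∀ x y : X, 0 ≤ μ x y)
    (hrow : ∀ x : X, HasSum (μ x) 1)
    (hirr : ∀ x y : X, x ≠ y → ∃ (n : ℕ) (p : ℕ → X), 1 ≤ n ∧ p 0 = x ∧ p n = y ∧
      ∀ j < n, 0 < μ (p j) (p (j + 1)))
    (hrev : ∀ x y : X, m x * μ x y = m y * μ y x)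
    (hmpos : ∀ x : X, 0 < m x)
    (hprob : HasSum m 1)
    (M : Lp ℝ 2 (weightMeasure m) →L[ℝ] Lp ℝ 2 (weightMeasure m))
    (hM : ∀ f : Lp ℝ 2 (weightMeasure m), ∀ᵐ x ∂(weightMeasure m),
      (M f) x = ∑' y : X, μ x y * f y)
    (E : Submodule ℝ (Lp ℝ 2 (weightMeasure m)))
    (hE : (E : Set (Lp ℝ 2 (weightMeasure m))) =
      {f : Lp ℝ 2 (weightMeasure m) | (∫ x, f x ∂(weightMeasure m)) = 0})
    (D : ↥E →L[ℝ] ↥E)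
    (hD : ∀ f : ↥E, ((D f : ↥E) : Lp ℝ 2 (weightMeasure m)) =
      (f : Lp ℝ 2 (weightMeasure m)) - M (f : Lp ℝ 2 (weightMeasure m))) :
    ∀ h lam : ℝ,
      h = sInf {r : ℝ | ∃ S : Set X, S.Nonempty ∧ Sᶜ.Nonempty ∧
        r = (∑' (x : S) (y : ↥Sᶜ), m x * μ x y) /
          ((∑' x : S, m (x : X)) * (∑' y : ↥Sᶜ, m (y : X)))} →
      lam = sInf (spectrum ℝ D) →
      h ^ 2 / 8 ≤ lam ∧ (0 < h → 0 < lam) := by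
  rintro h lam hh hlam
  have := isProbabilityMeasure_weightMeasure hmpos hprob
  have hcl : IsClosed (E : Set (Lp ℝ 2 (weightMeasure m))) :=
    hE ▸ isClosed_setOf_integral_eq_zero (weightMeasure m)
  have : CompleteSpace E := hcl.completeSpace_coe
  have hnn : ∀ S : Set X, 0 ≤ ∑' (x : S) (y : ↥Sᶜ), m x * μ x y := fun S =>
    tsum_nonneg fun x => tsum_nonneg fun y => mul_nonneg (hmpos _).le (hpos _ _)
  have hratio : ∀ r ∈ {r : ℝ | ∃ S : Set X, S.Nonempty ∧ Sᶜ.Nonempty ∧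
      r = (∑' (x : S) (y : ↥Sᶜ), m x * μ x y) /
        ((∑' x : S, m (x : X)) * (∑' y : ↥Sᶜ, m (y : X)))}, 0 ≤ r := by
    rintro r ⟨S, -, -, rfl⟩
    exact div_nonneg (hnn S) (mul_nonneg (tsum_nonneg fun x => (hmpos _).le)
      (tsum_nonneg fun x => (hmpos _).le))
  have hh0 : 0 ≤ h := hh ▸ Real.sInf_nonneg hratio
  have hmass : ∀ S : Set X, S.Nonempty → 0 < ∑' x : S, m x := fun S ⟨x, hx⟩ =>
    (hprob.summable.subtype S).tsum_pos (fun y => (hmpos _).le) ⟨x, hx⟩ (hmpos x)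
  have hcut : ∀ S : Set X, h * ((∑' x : S, m x) * ∑' y : ↥Sᶜ, m y) ≤
      ∑' (x : S) (y : ↥Sᶜ), m x * μ x y := fun S => by
    rcases S.eq_empty_or_nonempty with rfl | hS
    · simp
    rcases Sᶜ.eq_empty_or_nonempty with hS' | hS'
    · have : IsEmpty ↥Sᶜ := Set.isEmpty_coe_sort.2 hS'
      simp
    rw [← le_div_iff₀ (mul_pos (hmass S hS) (hmass _ hS')), hh]
    exact csInf_le ⟨0, hratio⟩ ⟨S, hS, hS', rfl⟩
  have hinner : ∀ f g : E, inner ℝ (D f) g =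
      inner ℝ (f : Lp ℝ 2 (weightMeasure m)) g - inner ℝ (M f) (g : Lp ℝ 2 (weightMeasure m)) :=
    fun f g => by rw [Submodule.coe_inner, hD, inner_sub_left]
  have hsymm : ∀ f g : E, inner ℝ (D f) g = inner ℝ f (D g) := fun f g => by
    rw [real_inner_comm (D g) f, hinner, hinner, inner_markov_comm hpos hrow hrev hmpos hM,
      real_inner_comm (M g) (f : Lp ℝ 2 (weightMeasure m)),
      real_inner_comm (g : Lp ℝ 2 (weightMeasure m)) (f : Lp ℝ 2 (weightMeasure m))]
  have hquad : ∀ f : E, h ^ 2 / 8 * ‖f‖ ^ 2 ≤ inner ℝ (D f) f := fun f => by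
    have hf0 : ∫ x, (f : Lp ℝ 2 (weightMeasure m)) x ∂(weightMeasure m) = 0 := by
      have : (f : Lp ℝ 2 (weightMeasure m)) ∈ (E : Set (Lp ℝ 2 (weightMeasure m))) := f.2
      rwa [hE] at this
    have hsum := hasSum_integral_weightMeasure hmpos
      ((Lp.memLp (f : Lp ℝ 2 (weightMeasure m))).integrable one_le_two)
    rw [hf0] at hsum
    have := sq_mul_tsum_sq_le_dirichlet hpos hrow hrev hmpos hprob hh0 hcut
      (summable_mul_sq_weightMeasure hmpos f) hsum
    rw [tsum_mul_sq_weightMeasure hmpos, ← inner_markov_eq_tsum hpos hrow hrev hmpos hM] at this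
    rw [hinner, real_inner_self_eq_norm_sq, Submodule.coe_norm]
    linarith
  have hspec : ∀ t ∈ spectrum ℝ D, h ^ 2 / 8 ≤ t := fun t ht =>
    le_of_mem_spectrum_of_forall_le_inner D hquad ht
  have hmain : h ^ 2 / 8 ≤ lam := by
    rw [hlam]
    rcases subsingleton_or_nontrivial X with hX | hX
    · have hzero : h = 0 := by
        rw [hh]
        convert Real.sInf_empty
        refine Set.eq_empty_of_forall_notMem ?_
        rintro r ⟨S, ⟨x, hx⟩, ⟨y, hy⟩, -⟩
        exact hy (Subsingleton.elim x y ▸ hx)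
      rw [hzero]
      refine le_trans (by norm_num) (Real.sInf_nonneg fun t ht => ?_)
      exact le_trans (by positivity) (hspec t ht)
    · obtain ⟨f, hf, hf0⟩ := exists_ne_zero_integral_eq_zero hmpos hprob
      have hfE : f ∈ E := by
        rw [← SetLike.mem_coe, hE]
        exact hf0
      have : Nontrivial E := ⟨⟨f, hfE⟩, 0, fun h => hf (congrArg Subtype.val h)⟩
      exact le_csInf (spectrum_nonempty_of_symmetric D hsymm) hspec
  exact ⟨hmain, fun hpos' => lt_of_lt_of_le (by positivity) hmain⟩
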